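/- arXiv:math/0601404 — 2 statements merged into one kernel-verified Lean document; each statement's English description precedes it below -/
import Mathlib

section
/- Fix N ≥ 1 and γ = 0, and assume Z > 0 for parameters {p1, p2, p3}. Let p_win denote the average winning probability of game B for parameters {p1, p2, p3} and p'_win that for the reflected parameters {1-p3, 1-p2, 1-p1}. Then p'_win = 1 - p_win; in particular, game B is fair (p_win = 1/2) for {p1, p2, p3} if and only if it is fair for {1-p3, 1-p2, 1-p1}. -/
open Finset

/-- Winning probability of game B at state `i` for parameters `p1, p2, p3`,
with `round x` the nearest integer to `x`. -/
noncomputable def gameB (N : ℕ) (p1 p2 p3 : ℝ) (i : ℕ) : ℝ :=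
  if round ((2 * N : ℝ) / 3) < (i : ℤ) then p1
  else if round ((N : ℝ) / 3) ≤ (i : ℤ) then p2
  else p3

/-- `a i = γ·pA + (1-γ)·p^B_i`. -/
noncomputable def aProb (N : ℕ) (pA p1 p2 p3 γ : ℝ) (i : ℕ) : ℝ :=
  γ * pA + (1 - γ) * gameB N p1 p2 p3 i

/-- Forward transition probability `p_i = ((N-i)/N)·a_i`. -/
noncomputable def fwd (N : ℕ) (pA p1 p2 p3 γ : ℝ) (i : ℕ) : ℝ :=
  (((N : ℝ) - (i : ℝ)) / (N : ℝ)) * aProb N pA p1 p2 p3 γ i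

/-- Backward transition probability `q_i = (i/N)·(1-a_i)`. -/
noncomputable def bwd (N : ℕ) (pA p1 p2 p3 γ : ℝ) (i : ℕ) : ℝ :=
  ((i : ℝ) / (N : ℝ)) * (1 - aProb N pA p1 p2 p3 γ i)

/-- Staying probability `r_i = 1 - p_i - q_i`. -/
noncomputable def stay (N : ℕ) (pA p1 p2 p3 γ : ℝ) (i : ℕ) : ℝ :=
  1 - fwd N pA p1 p2 p3 γ i - bwd N pA p1 p2 p3 γ i

/-- Unnormalized stationary weight `Π_i = (∏_{j=0}^{i-1} p_j)·(∏_{j=i+1}^{N} q_j)`. -/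
noncomputable def wt (N : ℕ) (pA p1 p2 p3 γ : ℝ) (i : ℕ) : ℝ :=
  (∏ j ∈ Finset.range i, fwd N pA p1 p2 p3 γ j) *
    (∏ j ∈ Finset.Icc (i + 1) N, bwd N pA p1 p2 p3 γ j)

/-- Normalization `Z = Σ_{i=0}^{N} Π_i`. -/
noncomputable def Znorm (N : ℕ) (pA p1 p2 p3 γ : ℝ) : ℝ :=
  ∑ i ∈ Finset.range (N + 1), wt N pA p1 p2 p3 γ i

/-- Stationary probability `P^st_i = Π_i / Z`. -/
noncomputable def Pst (N : ℕ) (pA p1 p2 p3 γ : ℝ) (i : ℕ) : ℝ :=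
  wt N pA p1 p2 p3 γ i / Znorm N pA p1 p2 p3 γ

/-- Average winning probability `p_win = Σ_{i=0}^{N} a_i · P^st_i`. -/
noncomputable def pwin (N : ℕ) (pA p1 p2 p3 γ : ℝ) : ℝ :=
  ∑ i ∈ Finset.range (N + 1), aProb N pA p1 p2 p3 γ i * Pst N pA p1 p2 p3 γ i

/-- Current `J = 2·p_win - 1`. -/
noncomputable def current (N : ℕ) (pA p1 p2 p3 γ : ℝ) : ℝ :=
  2 * pwin N pA p1 p2 p3 γ - 1

/-- Thirds of natural numbers are never ties, so rounding `2N/3` and `N/3` is complementary. -/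
theorem round_two_thirds_add_round_third (N : ℕ) :
    round ((2 * N : ℝ) / 3) + round ((N : ℝ) / 3) = N := by
  have key : ∀ m : ℕ, round ((m : ℝ) / 3) = (2 * (m : ℤ) + 3) / 6 := by
    intro m
    rw [round_eq, Int.floor_eq_iff]
    have h1 : 6 * ((2 * (m : ℤ) + 3) / 6) ≤ 2 * (m : ℤ) + 3 := by omega
    have h2 : 2 * (m : ℤ) + 3 < 6 * ((2 * (m : ℤ) + 3) / 6) + 6 := by omega
    generalize (2 * (m : ℤ) + 3) / 6 = c at h1 h2 ⊢
    have h1' : 6 * (c : ℝ) ≤ 2 * m + 3 := by exact_mod_cast h1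
    have h2' : 2 * (m : ℝ) + 3 < 6 * c + 6 := by exact_mod_cast h2
    constructor <;> linarith
  have h := key (2 * N)
  push_cast at h
  rw [h, key N]
  omega

theorem gameB_reflect (N : ℕ) (p1 p2 p3 : ℝ) {i : ℕ} (hi : i ≤ N) :
    gameB N (1 - p3) (1 - p2) (1 - p1) i = 1 - gameB N p1 p2 p3 (N - i) := by
  have h := round_two_thirds_add_round_third N
  have hle : round ((N : ℝ) / 3) ≤ round ((2 * N : ℝ) / 3) := by
    simp only [round_eq]
    have : (0 : ℝ) ≤ N := N.cast_nonneg
    exact Int.floor_le_floor (by linarith)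
  unfold gameB
  push_cast [Nat.cast_sub hi]
  split_ifs <;> first | rfl | (exfalso; omega)

theorem aProb_zero_reflect (N : ℕ) (pA p1 p2 p3 : ℝ) {i : ℕ} (hi : i ≤ N) :
    aProb N pA (1 - p3) (1 - p2) (1 - p1) 0 i = 1 - aProb N pA p1 p2 p3 0 (N - i) := by
  simp [aProb, gameB_reflect N p1 p2 p3 hi]

theorem fwd_zero_reflect (N : ℕ) (pA p1 p2 p3 : ℝ) {i : ℕ} (hi : i ≤ N) :
    fwd N pA (1 - p3) (1 - p2) (1 - p1) 0 i = bwd N pA p1 p2 p3 0 (N - i) := by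
  rw [fwd, bwd, aProb_zero_reflect N pA p1 p2 p3 hi, Nat.cast_sub hi]

theorem bwd_zero_reflect (N : ℕ) (pA p1 p2 p3 : ℝ) {i : ℕ} (hi : i ≤ N) :
    bwd N pA (1 - p3) (1 - p2) (1 - p1) 0 i = fwd N pA p1 p2 p3 0 (N - i) := by
  rw [fwd, bwd, aProb_zero_reflect N pA p1 p2 p3 hi, Nat.cast_sub hi, sub_sub_cancel,
    sub_sub_cancel]

theorem wt_zero_reflect (N : ℕ) (pA p1 p2 p3 : ℝ) {i : ℕ} (hi : i ≤ N) :
    wt N pA (1 - p3) (1 - p2) (1 - p1) 0 i = wt N pA p1 p2 p3 0 (N - i) := by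
  unfold wt
  rw [mul_comm]
  congr 1
  · refine Finset.prod_bij' (fun j _ => N - j) (fun j _ => N - j) ?_ ?_ ?_ ?_ ?_ <;>
      intro j hj <;> simp only [Finset.mem_Icc, Finset.mem_range] at hj ⊢
    iterate 4 omega
    exact bwd_zero_reflect N pA p1 p2 p3 hj.2
  · refine Finset.prod_bij' (fun j _ => N - j) (fun j _ => N - j) ?_ ?_ ?_ ?_ ?_ <;>
      intro j hj <;> simp only [Finset.mem_Icc, Finset.mem_range] at hj ⊢
    iterate 4 omega
    exact fwd_zero_reflect N pA p1 p2 p3 (by omega)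

theorem Znorm_zero_reflect (N : ℕ) (pA p1 p2 p3 : ℝ) :
    Znorm N pA (1 - p3) (1 - p2) (1 - p1) 0 = Znorm N pA p1 p2 p3 0 := by
  unfold Znorm
  rw [← Finset.sum_range_reflect (fun i => wt N pA p1 p2 p3 0 i)]
  refine Finset.sum_congr rfl fun i hi => ?_
  rw [wt_zero_reflect N pA p1 p2 p3 (Finset.mem_range_succ_iff.mp hi), Nat.add_sub_cancel]

theorem sum_Pst (N : ℕ) (pA p1 p2 p3 γ : ℝ) (hZ : Znorm N pA p1 p2 p3 γ ≠ 0) :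
    ∑ i ∈ Finset.range (N + 1), Pst N pA p1 p2 p3 γ i = 1 := by
  simp only [Pst]
  rw [← Finset.sum_div]
  exact div_self hZ

theorem pwin_zero_reflect (N : ℕ) (pA p1 p2 p3 : ℝ) (hZ : Znorm N pA p1 p2 p3 0 ≠ 0) :
    pwin N pA (1 - p3) (1 - p2) (1 - p1) 0 = 1 - pwin N pA p1 p2 p3 0 := by
  refine Eq.trans ?_ (congrArg (· - pwin N pA p1 p2 p3 0) (sum_Pst N pA p1 p2 p3 0 hZ))
  simp only [pwin]
  rw [← Finset.sum_sub_distrib, ← Finset.sum_range_reflect (fun i => Pst N pA p1 p2 p3 0 i - _)]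
  refine Finset.sum_congr rfl fun i hi => ?_
  have hi' := Finset.mem_range_succ_iff.mp hi
  rw [Nat.add_sub_cancel, aProb_zero_reflect N pA p1 p2 p3 hi', Pst, Pst,
    wt_zero_reflect N pA p1 p2 p3 hi', Znorm_zero_reflect]
  ring

/-- for `γ = 0` and `Z > 0`, the average winning probability for the
reflected parameters `{1-p3,1-p2,1-p1}` is `p'_win = 1 - p_win`; in particular game B
is fair for `{p1,p2,p3}` iff it is fair for `{1-p3,1-p2,1-p1}`. -/
theorem pwin_reflect (N : ℕ) (hN : 1 ≤ N) (pA p1 p2 p3 : ℝ)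
    (hp1 : p1 ∈ Set.Icc (0 : ℝ) 1) (hp2 : p2 ∈ Set.Icc (0 : ℝ) 1)
    (hp3 : p3 ∈ Set.Icc (0 : ℝ) 1)
    (hZ : 0 < Znorm N pA p1 p2 p3 0) :
    pwin N pA (1 - p3) (1 - p2) (1 - p1) 0 = 1 - pwin N pA p1 p2 p3 0 ∧
      (pwin N pA p1 p2 p3 0 = 1 / 2 ↔ pwin N pA (1 - p3) (1 - p2) (1 - p1) 0 = 1 / 2) := by
  have h := pwin_zero_reflect N pA p1 p2 p3 hZ.ne'
  refine ⟨h, ?_⟩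
  rw [h]
  constructor <;> intro _ <;> linarith
end

section
/- For N = 2 players with p_A = 1/2 and game-B parameters satisfying p1 = p3 ∈ (0,1) and p2 = 1 - p1 (the value making game B fair), the combined game A+B is fair for every mixing probability γ ∈ [0,1]: the stationary distribution is symmetric (P^st_0 = P^st_2) and p_win^{A+B} = 1/2, independent of γ. -/
open Finset

section TwoPlayers

variable (pA p1 p2 p3 γ : ℝ)

theorem round_two_thirds : round (((2 : ℕ) : ℝ) / 3) = 1 := by
  rw [round_eq, Int.floor_eq_iff]
  norm_num

theorem round_four_thirds : round ((2 * (2 : ℕ) : ℝ) / 3) = 1 := by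
  rw [round_eq, Int.floor_eq_iff]
  norm_num

theorem gameB_two_zero : gameB 2 p1 p2 p3 0 = p3 := by
  rw [gameB, round_two_thirds, round_four_thirds]
  norm_num

theorem gameB_two_one : gameB 2 p1 p2 p3 1 = p2 := by
  rw [gameB, round_two_thirds, round_four_thirds]
  norm_num

theorem gameB_two_two : gameB 2 p1 p2 p3 2 = p1 := by
  rw [gameB, round_two_thirds, round_four_thirds]
  norm_num

theorem wt_two_zero :
    wt 2 pA p1 p2 p3 γ 0 = bwd 2 pA p1 p2 p3 γ 1 * bwd 2 pA p1 p2 p3 γ 2 := by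
  simp [wt, Finset.prod_Icc_succ_top]

theorem wt_two_one :
    wt 2 pA p1 p2 p3 γ 1 = fwd 2 pA p1 p2 p3 γ 0 * bwd 2 pA p1 p2 p3 γ 2 := by
  simp [wt]

theorem wt_two_two :
    wt 2 pA p1 p2 p3 γ 2 = fwd 2 pA p1 p2 p3 γ 0 * fwd 2 pA p1 p2 p3 γ 1 := by
  simp [wt, Finset.prod_range_succ]

end TwoPlayers

/-- A convex combination of `1 / 2` and a point of `(0, 1)` lies in `(0, 1)`. -/
theorem mix_half_mem_Ioo {p γ : ℝ} (hp : p ∈ Set.Ioo (0 : ℝ) 1) (hγ : γ ∈ Set.Icc (0 : ℝ) 1) :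
    γ * (1 / 2) + (1 - γ) * p ∈ Set.Ioo (0 : ℝ) 1 :=
  convex_Ioo (0 : ℝ) 1 (by norm_num) hp hγ.1 (sub_nonneg.2 hγ.2) (by ring)

/-- for `N = 2` players with `p_A = 1/2`, `p1 = p3 ∈ (0,1)` and
`p2 = 1 - p1`, the combined game `A+B` is fair for every `γ ∈ [0,1]`: the
stationary distribution is symmetric (`P^st_0 = P^st_2`) and `p_win^{A+B} = 1/2`. -/
theorem fair_N2_symmetric (p1 γ : ℝ)
    (hp1 : p1 ∈ Set.Ioo (0 : ℝ) 1) (hγ : γ ∈ Set.Icc (0 : ℝ) 1) :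
    Pst 2 (1 / 2) p1 (1 - p1) p1 γ 0 = Pst 2 (1 / 2) p1 (1 - p1) p1 γ 2 ∧
      pwin 2 (1 / 2) p1 (1 - p1) p1 γ = 1 / 2 := by
  obtain ⟨a, ha⟩ : ∃ a, a = γ * (1 / 2) + (1 - γ) * p1 := ⟨_, rfl⟩
  have ha01 : a ∈ Set.Ioo (0 : ℝ) 1 := ha ▸ mix_half_mem_Ioo hp1 hγ
  have a_zero : aProb 2 (1 / 2) p1 (1 - p1) p1 γ 0 = a := by
    rw [aProb, gameB_two_zero, ha]
  have a_one : aProb 2 (1 / 2) p1 (1 - p1) p1 γ 1 = 1 - a := by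
    rw [aProb, gameB_two_one, ha]
    ring
  have a_two : aProb 2 (1 / 2) p1 (1 - p1) p1 γ 2 = a := by
    rw [aProb, gameB_two_two, ha]
  have w_zero : wt 2 (1 / 2) p1 (1 - p1) p1 γ 0 = a * (1 - a) / 2 := by
    rw [wt_two_zero, bwd, bwd, a_one, a_two]
    push_cast
    ring
  have w_one : wt 2 (1 / 2) p1 (1 - p1) p1 γ 1 = a * (1 - a) := by
    rw [wt_two_one, fwd, bwd, a_zero, a_two]
    push_cast
    ring
  have w_two : wt 2 (1 / 2) p1 (1 - p1) p1 γ 2 = a * (1 - a) / 2 := by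
    rw [wt_two_two, fwd, fwd, a_zero, a_one]
    push_cast
    ring
  have hZ : Znorm 2 (1 / 2) p1 (1 - p1) p1 γ = 2 * (a * (1 - a)) := by
    simp only [Znorm, Finset.sum_range_succ, Finset.sum_range_zero, w_zero, w_one, w_two]
    ring
  have ha0 : a ≠ 0 := ha01.1.ne'
  have ha1 : 1 - a ≠ 0 := (sub_pos.2 ha01.2).ne'
  refine ⟨by rw [Pst, Pst, w_zero, w_two], ?_⟩
  simp only [pwin, Pst, Finset.sum_range_succ, Finset.sum_range_zero, a_zero, a_one, a_two,
    w_zero, w_one, w_two, hZ]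
  field_simp
  ring
end
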